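/- Let (α, μ) be a measure space, S a measurable set in α, and g, g' : α → ℝ two measurable functions that are strictly positive on S with 0 < ∫_S g dμ < ∞ and 0 < ∫_S g' dμ < ∞. Define the normalized density h_{g'}(x) = g'(x) / ∫_S g' dμ, and assume that x ↦ h_{g'}(x)·log g(x) and x ↦ h_{g'}(x)·log g'(x) are integrable on S with respect to μ. Then log(∫_S g dμ) − log(∫_S g' dμ) ≥ ∫_S h_{g'}(x)·log g(x) dμ(x) − ∫_S h_{g'}(x)·log g'(x) dμ(x). -/

import Mathlib

open MeasureTheory

/-- Key EM lemma: `log ∫_S g − log ∫_S g' ≥ ∫_S h_{g'} log g − ∫_S h_{g'} log g'`,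
where `h_{g'} = g' / ∫_S g'`. -/
theorem em_key_lemma {α : Type*} [MeasurableSpace α] (μ : Measure α)
    (S : Set α) (hS : MeasurableSet S) (g g' : α → ℝ)
    (hgm : Measurable g) (hg'm : Measurable g')
    (hgpos : ∀ x ∈ S, 0 < g x) (hg'pos : ∀ x ∈ S, 0 < g' x)
    (hgint : IntegrableOn g S μ) (hg'int : IntegrableOn g' S μ)
    (hgIpos : 0 < ∫ x in S, g x ∂μ) (hg'Ipos : 0 < ∫ x in S, g' x ∂μ)
    (hint1 : IntegrableOn
      (fun x => (g' x / ∫ y in S, g' y ∂μ) * Real.log (g x)) S μ)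
    (hint2 : IntegrableOn
      (fun x => (g' x / ∫ y in S, g' y ∂μ) * Real.log (g' x)) S μ) :
    Real.log (∫ x in S, g x ∂μ) - Real.log (∫ x in S, g' x ∂μ) ≥
      (∫ x in S, (g' x / ∫ y in S, g' y ∂μ) * Real.log (g x) ∂μ) -
        ∫ x in S, (g' x / ∫ y in S, g' y ∂μ) * Real.log (g' x) ∂μ := by
  set A := ∫ x in S, g x ∂μ with hA
  set B := ∫ x in S, g' x ∂μ with hB
  rw [ge_iff_le, ← integral_sub hint1 hint2]
  have hi1 : Integrable (fun x => g x / A) (μ.restrict S) := Integrable.div_const hgint A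
  have hi2 : Integrable (fun x => (Real.log A - Real.log B - 1) * (g' x / B)) (μ.restrict S) :=
    (Integrable.div_const hg'int B).const_mul _
  have key : ∫ x in S, (g x / A + (Real.log A - Real.log B - 1) * (g' x / B)) ∂μ
      = Real.log A - Real.log B := by
    rw [integral_add hi1 hi2, integral_const_mul, integral_div, integral_div, ← hA, ← hB,
      div_self hgIpos.ne', div_self hg'Ipos.ne']
    ring
  rw [← key]
  refine setIntegral_mono_on (hint1.sub hint2) (hi1.add hi2) hS ?_
  intro x hx
  have hg := hgpos x hx
  have hg' := hg'pos x hx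
  have h1 := Real.log_le_sub_one_of_pos (x := (g x / A) / (g' x / B)) (by positivity)
  rw [Real.log_div (by positivity) (by positivity), Real.log_div hg.ne' hgIpos.ne',
    Real.log_div hg'.ne' hg'Ipos.ne'] at h1
  have hp : 0 < g' x / B := by positivity
  have h2 := mul_le_mul_of_nonneg_left h1 hp.le
  have h3 : g' x / B * ((g x / A) / (g' x / B) - 1) = g x / A - g' x / B := by
    rw [mul_sub, mul_div_cancel₀ _ hp.ne', mul_one]
  rw [h3] at h2
  linarith
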